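/- With the block fundamental-solution setup below, assume in addition there is L' ≥ 0 with ‖M(t) − M(0)‖₂ ≤ L' for all t ∈ [0,1]. Then for all t ∈ [0,1]: ‖C(t) − t·M(0)‖₂ ≤ ((L' + L²/2)/√L)·sinh(√L·t). -/

import Mathlib

/-- The operator norm of a real `d × d` matrix induced by the Euclidean norm on `ℝ^d`. -/
noncomputable def opNorm2 {d : ℕ} (A : Matrix (Fin d) (Fin d) ℝ) : ℝ :=
  ‖LinearMap.toContinuousLinearMap (Matrix.toEuclideanLin A)‖

theorem Real.sinh_le_self_mul_cosh {x : ℝ} (hx : 0 ≤ x) : sinh x ≤ x * cosh x := by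
  have h := image_norm_le_of_norm_deriv_right_le_deriv_boundary (a := 0) (b := x)
    (f := sinh) (f' := cosh) (B := fun t => t * cosh t)
    (B' := fun t => 1 * cosh t + t * sinh t)
    continuous_sinh.continuousOn (fun t _ => (hasDerivAt_sinh t).hasDerivWithinAt) (by simp)
    (fun t => (hasDerivAt_id t).mul (hasDerivAt_cosh t))
    (fun t ht => by
      rw [norm_of_nonneg (cosh_pos t).le]
      have := mul_nonneg ht.1 (sinh_nonneg_iff.2 ht.1)
      linarith)
    (Set.right_mem_Icc.2 hx)
  exact (le_norm_self _).trans h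

theorem Real.cosh_sub_one_le {x : ℝ} (hx : 0 ≤ x) : cosh x - 1 ≤ x ^ 2 / 2 * cosh x := by
  obtain ⟨y, rfl⟩ : ∃ y, x = 2 * y := ⟨x / 2, by ring⟩
  have hy : 0 ≤ y := by linarith
  have h : sinh y ^ 2 ≤ (y * cosh y) ^ 2 :=
    pow_le_pow_left₀ (sinh_nonneg_iff.2 hy) (sinh_le_self_mul_cosh hy) 2
  rw [cosh_two_mul, cosh_sq]
  rw [mul_pow, cosh_sq] at h
  nlinarith [mul_nonneg (sq_nonneg y) (sq_nonneg (sinh y))]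

theorem hasDerivAt_sinh_const_mul (k t : ℝ) :
    HasDerivAt (fun s => Real.sinh (k * s)) (k * Real.cosh (k * t)) t := by
  simpa [mul_comm] using ((hasDerivAt_id t).const_mul k).sinh

theorem hasDerivAt_cosh_const_mul (k t : ℝ) :
    HasDerivAt (fun s => Real.cosh (k * s)) (k * Real.sinh (k * t)) t := by
  simpa [mul_comm] using ((hasDerivAt_id t).const_mul k).cosh

section NormedAlgebra

variable {R : Type*} [NormedRing R] [NormedAlgebra ℝ R]

/-- For a solution of the second-order equation with coefficient `m`, `‖m‖ ≤ k ^ 2`, started at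
`1` with zero velocity, the bound `‖a‖ ≤ q cosh (k t)` improves to `‖a - 1‖ ≤ q (cosh (k t) - 1)`. -/
theorem norm_sub_one_le_of_norm_le_mul_cosh {m a c : ℝ → R} {k T q : ℝ}
    (hm : ∀ t ∈ Set.Icc 0 T, ‖m t‖ ≤ k ^ 2) (ha0 : a 0 = 1) (hc0 : c 0 = 0)
    (ha : ∀ t ∈ Set.Icc 0 T, HasDerivAt a (c t) t)
    (hc : ∀ t ∈ Set.Icc 0 T, HasDerivAt c (m t * a t) t)
    (hq : ∀ t ∈ Set.Icc 0 T, ‖a t‖ ≤ q * Real.cosh (k * t)) :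
    ∀ t ∈ Set.Icc 0 T, ‖a t - 1‖ ≤ q * (Real.cosh (k * t) - 1) := by
  have hcb : ∀ t ∈ Set.Icc 0 T, ‖c t‖ ≤ q * (k * Real.sinh (k * t)) := by
    refine image_norm_le_of_norm_deriv_right_le_deriv_boundary
      (f' := fun t => m t * a t) (B' := fun t => q * (k * (k * Real.cosh (k * t))))
      (fun t ht => (hc t ht).continuousAt.continuousWithinAt)
      (fun t ht => (hc t (Set.Ico_subset_Icc_self ht)).hasDerivWithinAt) (by simp [hc0])
      (fun t => ((hasDerivAt_sinh_const_mul k t).const_mul k).const_mul q) fun t ht => ?_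
    have ht' := Set.Ico_subset_Icc_self ht
    calc ‖m t * a t‖ ≤ ‖m t‖ * ‖a t‖ := norm_mul_le _ _
      _ ≤ k ^ 2 * (q * Real.cosh (k * t)) := by
        gcongr
        exacts [hm t ht', hq t ht']
      _ = _ := by ring
  exact image_norm_le_of_norm_deriv_right_le_deriv_boundary
    (f' := c) (B' := fun t => q * (k * Real.sinh (k * t)))
    (fun t ht => ((ha t ht).sub_const 1).continuousAt.continuousWithinAt)
    (fun t ht => ((ha t (Set.Ico_subset_Icc_self ht)).sub_const 1).hasDerivWithinAt)
    (by simp [ha0])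
    (fun t => ((hasDerivAt_cosh_const_mul k t).sub_const 1).const_mul q)
    fun t ht => hcb t (Set.Ico_subset_Icc_self ht)

theorem norm_sub_one_le_cosh_sub_one {m a c : ℝ → R} {k T : ℝ} (h1 : ‖(1 : R)‖ ≤ 1)
    (hm : ∀ t ∈ Set.Icc 0 T, ‖m t‖ ≤ k ^ 2) (ha0 : a 0 = 1) (hc0 : c 0 = 0)
    (ha : ∀ t ∈ Set.Icc 0 T, HasDerivAt a (c t) t)
    (hc : ∀ t ∈ Set.Icc 0 T, HasDerivAt c (m t * a t) t) :
    ∀ t ∈ Set.Icc 0 T, ‖a t - 1‖ ≤ Real.cosh (k * t) - 1 := by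
  intro t ht
  have hcont : ContinuousOn (fun s => ‖a s‖ / Real.cosh (k * s)) (Set.Icc 0 T) :=
    ContinuousOn.div (fun s hs => (ha s hs).continuousAt.norm.continuousWithinAt)
      (by fun_prop) fun s _ => (Real.cosh_pos _).ne'
  obtain ⟨r, hr, hmax⟩ := isCompact_Icc.exists_isMaxOn ⟨t, ht⟩ hcont
  set q := ‖a r‖ / Real.cosh (k * r) with hqdef
  have hq : ∀ s ∈ Set.Icc 0 T, ‖a s‖ ≤ q * Real.cosh (k * s) := fun s hs =>
    (div_le_iff₀ (Real.cosh_pos _)).1 (hmax hs)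
  have key := norm_sub_one_le_of_norm_le_mul_cosh hm ha0 hc0 ha hc hq
  have hq1 : q ≤ 1 := by
    have hr1 : ‖a r‖ = q * Real.cosh (k * r) := (div_mul_cancel₀ _ (Real.cosh_pos _).ne').symm
    have hr2 : ‖a r‖ ≤ ‖a r - 1‖ + ‖(1 : R)‖ := by
      simpa using norm_add_le (a r - 1) 1
    linarith [key r hr]
  exact (key t ht).trans
    (mul_le_of_le_one_left (sub_nonneg.2 (Real.one_le_cosh _)) hq1)

theorem norm_sub_smul_le_sinh {m a c : ℝ → R} {k δ : ℝ} (h1 : ‖(1 : R)‖ ≤ 1) (hk : 0 < k)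
    (hδ : 0 ≤ δ) (hm : ∀ t ∈ Set.Icc (0 : ℝ) 1, ‖m t‖ ≤ k ^ 2)
    (hmδ : ∀ t ∈ Set.Icc (0 : ℝ) 1, ‖m t - m 0‖ ≤ δ) (ha0 : a 0 = 1) (hc0 : c 0 = 0)
    (ha : ∀ t ∈ Set.Icc (0 : ℝ) 1, HasDerivAt a (c t) t)
    (hc : ∀ t ∈ Set.Icc (0 : ℝ) 1, HasDerivAt c (m t * a t) t) :
    ∀ t ∈ Set.Icc (0 : ℝ) 1,
      ‖c t - t • m 0‖ ≤ (δ + (k ^ 2) ^ 2 / 2) / k * Real.sinh (k * t) := by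
  have hF : ∀ t ∈ Set.Icc (0 : ℝ) 1,
      HasDerivAt (fun s => c s - s • m 0) (m t * a t - (1 : ℝ) • m 0) t := fun t ht =>
    (hc t ht).sub ((hasDerivAt_id t).smul_const (m 0))
  refine image_norm_le_of_norm_deriv_right_le_deriv_boundary
    (f' := fun t => m t * a t - (1 : ℝ) • m 0)
    (B' := fun t => (δ + (k ^ 2) ^ 2 / 2) / k * (k * Real.cosh (k * t)))
    (fun t ht => (hF t ht).continuousAt.continuousWithinAt)
    (fun t ht => (hF t (Set.Ico_subset_Icc_self ht)).hasDerivWithinAt) (by simp [hc0])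
    (fun t => (hasDerivAt_sinh_const_mul k t).const_mul _) fun t ht => ?_
  have ht' := Set.Ico_subset_Icc_self ht
  have hcosh : Real.cosh (k * t) - 1 ≤ k ^ 2 / 2 * Real.cosh (k * t) := by
    refine (Real.cosh_sub_one_le (mul_nonneg hk.le ht.1)).trans ?_
    have hkt : k * t ≤ k := mul_le_of_le_one_right hk.le ht'.2
    have := mul_nonneg hk.le ht.1
    have := Real.cosh_pos (k * t)
    gcongr
  calc ‖m t * a t - (1 : ℝ) • m 0‖ = ‖m t * (a t - 1) + (m t - m 0)‖ := by
        rw [one_smul, mul_sub, mul_one, sub_add_sub_cancel]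
    _ ≤ ‖m t‖ * ‖a t - 1‖ + ‖m t - m 0‖ :=
        (norm_add_le _ _).trans (by gcongr; exact norm_mul_le _ _)
    _ ≤ k ^ 2 * (k ^ 2 / 2 * Real.cosh (k * t)) + δ * Real.cosh (k * t) := by
        gcongr
        · exact hm t ht'
        · exact (norm_sub_one_le_cosh_sub_one h1 hm ha0 hc0 ha hc t ht').trans hcosh
        · exact (hmδ t ht').trans (le_mul_of_one_le_right hδ (Real.one_le_cosh _))
    _ = (δ + (k ^ 2) ^ 2 / 2) / k * (k * Real.cosh (k * t)) := by
        field_simp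
        ring

end NormedAlgebra

theorem opNorm2_eq_norm_toEuclideanCLM {d : ℕ} (X : Matrix (Fin d) (Fin d) ℝ) :
    opNorm2 X = ‖Matrix.toEuclideanCLM (𝕜 := ℝ) X‖ := rfl

theorem hasDerivAt_toEuclideanCLM {d : ℕ} {X : ℝ → Matrix (Fin d) (Fin d) ℝ}
    {X' : Matrix (Fin d) (Fin d) ℝ} {t : ℝ}
    (h : ∀ i j, HasDerivAt (fun s => X s i j) (X' i j) t) :
    HasDerivAt (fun s => Matrix.toEuclideanCLM (𝕜 := ℝ) (X s))
      (Matrix.toEuclideanCLM (𝕜 := ℝ) X') t := by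
  have hsum : ∀ Y : Matrix (Fin d) (Fin d) ℝ, Matrix.toEuclideanCLM (𝕜 := ℝ) Y =
      ∑ i, ∑ j, Y i j • Matrix.toEuclideanCLM (𝕜 := ℝ) (Matrix.single i j (1 : ℝ)) := fun Y => by
    conv_lhs => rw [Matrix.matrix_eq_sum_single Y]
    simp only [map_sum, ← map_smul, Matrix.smul_single, smul_eq_mul, mul_one]
  simp only [hsum (X _), hsum X']
  refine HasDerivAt.fun_sum fun i _ => HasDerivAt.fun_sum fun j _ => ?_
  exact HasDerivAt.smul_const (F := EuclideanSpace ℝ (Fin d) →L[ℝ] EuclideanSpace ℝ (Fin d))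
    (h i j) (Matrix.toEuclideanCLM (𝕜 := ℝ) (Matrix.single i j (1 : ℝ)))

/-- Lemma `matrix-exponent-block-bounds-second-order`: for the block fundamental
solution `[[A,B],[C,D]]` of `[[0,I],[M(t),0]]` with `‖M(t)‖₂ ≤ L` and
`‖M(t) − M(0)‖₂ ≤ L'` on `[0,1]`, one has
`‖C(t) − t·M(0)‖₂ ≤ ((L' + L²/2)/√L)·sinh(√L t)` for all `t ∈ [0,1]`. -/
theorem stmt_6 (d : ℕ) (L L' : ℝ) (hL : 0 < L) (hL' : 0 ≤ L')
    (M : ℝ → Matrix (Fin d) (Fin d) ℝ) (hMcont : Continuous M)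
    (hMbound : ∀ t, 0 ≤ t → opNorm2 (M t) ≤ L)
    (hMvar : ∀ t ∈ Set.Icc (0:ℝ) 1, opNorm2 (M t - M 0) ≤ L')
    (A B C D : ℝ → Matrix (Fin d) (Fin d) ℝ)
    (hA0 : A 0 = 1) (hB0 : B 0 = 0) (hC0 : C 0 = 0) (hD0 : D 0 = 1)
    (hA : ∀ t, 0 ≤ t → ∀ i j, HasDerivAt (fun s => A s i j) (C t i j) t)
    (hB : ∀ t, 0 ≤ t → ∀ i j, HasDerivAt (fun s => B s i j) (D t i j) t)
    (hC : ∀ t, 0 ≤ t → ∀ i j, HasDerivAt (fun s => C s i j) ((M t * A t) i j) t)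
    (hD : ∀ t, 0 ≤ t → ∀ i j, HasDerivAt (fun s => D s i j) ((M t * B t) i j) t) :
    ∀ t ∈ Set.Icc (0:ℝ) 1,
      opNorm2 (C t - t • M 0) ≤
        ((L' + L ^ 2 / 2) / Real.sqrt L) * Real.sinh (Real.sqrt L * t) := by
  have hk : Real.sqrt L ^ 2 = L := Real.sq_sqrt hL.le
  intro t ht
  have h := norm_sub_smul_le_sinh (k := Real.sqrt L) (δ := L')
    (m := fun s => Matrix.toEuclideanCLM (𝕜 := ℝ) (M s))
    (a := fun s => Matrix.toEuclideanCLM (𝕜 := ℝ) (A s))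
    (c := fun s => Matrix.toEuclideanCLM (𝕜 := ℝ) (C s))
    ContinuousLinearMap.norm_id_le (Real.sqrt_pos.2 hL) hL'
    (fun s hs => hk.symm ▸ hMbound s hs.1)
    (fun s hs => by
      rw [← map_sub]
      exact hMvar s hs)
    (by simp [hA0]) (by simp [hC0])
    (fun s hs => hasDerivAt_toEuclideanCLM (hA s hs.1))
    (fun s hs => by
      rw [← map_mul]
      exact hasDerivAt_toEuclideanCLM (hC s hs.1)) t ht
  rw [hk] at h
  rwa [opNorm2_eq_norm_toEuclideanCLM, map_sub, map_smul]
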